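/- The assignments ψ_c^±(t) = c² t^{-1}, ψ_c^±(u) = ± c^{n+1} t^{-n-1} u extend to ℂ-algebra automorphisms of R satisfying (ψ_c^±)² = id. Moreover, the automorphism ψ_c^+ ∘ φ_ξ^+ ∘ (ψ_c^+)^{-1} sends t ↦ ξ^{-2} t and u ↦ (−1)^{l} ξ^{-1} u, where l = 2n/k. -/

import Mathlib

open scoped BigOperators

noncomputable section

/-- The hyperelliptic ring `R = ℂ[t,t⁻¹,u : u² = p(t)]`, realized as
`ℂ[t,t⁻¹][X]/(X² - p)`. -/
abbrev HypRing (p : LaurentPolynomial ℂ) : Type :=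
  AdjoinRoot (Polynomial.X ^ 2 - Polynomial.C p)

/-- The element `t^i` of `R`, for `i : ℤ`. -/
noncomputable def tP (p : LaurentPolynomial ℂ) (i : ℤ) : HypRing p :=
  AdjoinRoot.of _ (LaurentPolynomial.T i)

/-- The element `u` of `R`. -/
noncomputable def uE (p : LaurentPolynomial ℂ) : HypRing p := AdjoinRoot.root _

/-- The module of Kähler differentials `Ω_R` of `R` over `ℂ`. -/
abbrev HypOmega (p : LaurentPolynomial ℂ) := KaehlerDifferential ℂ (HypRing p)

/-- The subspace `dR ⊆ Ω_R` of exact differentials. -/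
noncomputable def dSub (p : LaurentPolynomial ℂ) : Submodule ℂ (HypOmega p) :=
  LinearMap.range (KaehlerDifferential.D ℂ (HypRing p)).toLinearMap

/-- The quotient `Ω_R/dR`. -/
abbrev HypCenter (p : LaurentPolynomial ℂ) := HypOmega p ⧸ dSub p

/-- The class `\overline{f dg}` of `f dg` in `Ω_R/dR`. -/
noncomputable def cls (p : LaurentPolynomial ℂ) (f g : HypRing p) : HypCenter p :=
  Submodule.Quotient.mk (f • (KaehlerDifferential.D ℂ (HypRing p) g))

/-- `ω₀ = \overline{t⁻¹ dt}` and `ω_k = \overline{t^{-k} u dt}` for `k ≥ 1`. -/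
noncomputable def om (p : LaurentPolynomial ℂ) (k : ℕ) : HypCenter p :=
  if k = 0 then cls p (tP p (-1)) (tP p 1)
  else cls p (tP p (-(k : ℤ)) * uE p) (tP p 1)
lemma tP_zero (p : LaurentPolynomial ℂ) : tP p 0 = 1 := by
  simp [tP]

lemma tP_add (p : LaurentPolynomial ℂ) (i j : ℤ) : tP p (i + j) = tP p i * tP p j := by
  rw [tP, LaurentPolynomial.T_add, map_mul]
  rfl

lemma tP_pow (p : LaurentPolynomial ℂ) (i : ℤ) (m : ℕ) : tP p i ^ m = tP p (m * i) := by
  simp [tP, ← map_pow, LaurentPolynomial.T_pow]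

lemma uE_sq (p : LaurentPolynomial ℂ) : uE p ^ 2 = AdjoinRoot.of _ p := by
  have h := AdjoinRoot.eval₂_root (Polynomial.X ^ 2 - Polynomial.C p)
  simpa [sub_eq_zero, uE] using h

lemma of_C (p : LaurentPolynomial ℂ) (a : ℂ) :
    AdjoinRoot.of (Polynomial.X ^ 2 - Polynomial.C p) (LaurentPolynomial.C a) =
      algebraMap ℂ (HypRing p) a := rfl

/-- The multiplicative family `i ↦ a^i t^{ij}` of elements of `R`. -/
def scaledPowers (p : LaurentPolynomial ℂ) (a : ℂ) (ha : a ≠ 0) (j : ℤ) :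
    Multiplicative ℤ →* HypRing p where
  toFun i := a ^ i.toAdd • tP p (i.toAdd * j)
  map_one' := by simp [tP_zero]
  map_mul' x y := by
    rw [toAdd_mul, zpow_add₀ ha, add_mul, tP_add, smul_mul_smul_comm]

/-- An algebra homomorphism on `R` sending `t` to `a t^j` sends `t^i` to `a^i t^{ij}`. -/
lemma map_tP {p : LaurentPolynomial ℂ} (f : HypRing p →ₐ[ℂ] HypRing p) {a : ℂ} (ha : a ≠ 0)
    {j : ℤ} (h : f (tP p 1) = a • tP p j) (i : ℤ) : f (tP p i) = a ^ i • tP p (i * j) := by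
  have key : (f : HypRing p →* HypRing p).comp (scaledPowers p 1 one_ne_zero 1) =
      scaledPowers p a ha j := by
    apply MonoidHom.ext_mint
    simpa [scaledPowers] using h
  simpa [scaledPowers] using DFunLike.congr_fun key (Multiplicative.ofAdd i)

/-- Algebra endomorphisms of `R` are determined by their values on `t` and `u`. -/
lemma hypRing_algHom_ext {p : LaurentPolynomial ℂ} {f g : HypRing p →ₐ[ℂ] HypRing p}
    (ht : f (tP p 1) = g (tP p 1)) (hu : f (uE p) = g (uE p)) : f = g := by
  apply AdjoinRoot.algHom_ext' _ hu
  apply AddMonoidAlgebra.algHom_ext'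
  · apply MonoidHom.ext_mint
    exact ht
  · ext

/-- If `p(a t⁻¹) = b² t^{2m} p(t)`, then `t ↦ a t⁻¹`, `u ↦ b t^m u` extends to `R`. -/
lemma exists_algHom_inversion {p : LaurentPolynomial ℂ} {a b : ℂ} (ha : a ≠ 0) {m : ℤ}
    (h : AddMonoidAlgebra.lift ℂ (HypRing p) ℤ (scaledPowers p a ha (-1)) p =
      (b • (tP p m * uE p)) ^ 2) :
    ∃ f : HypRing p →ₐ[ℂ] HypRing p,
      f (tP p 1) = a • tP p (-1) ∧ f (uE p) = b • (tP p m * uE p) := by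
  refine ⟨AdjoinRoot.liftAlgHom _
    (AddMonoidAlgebra.lift ℂ (HypRing p) ℤ (scaledPowers p a ha (-1)))
    (b • (tP p m * uE p)) ?_, ?_, ?_⟩
  · rw [Polynomial.eval₂_sub, Polynomial.eval₂_X_pow, Polynomial.eval₂_C, sub_eq_zero]
    exact h.symm
  · rw [show tP p 1 = AdjoinRoot.of _ (LaurentPolynomial.T 1) from rfl,
      AdjoinRoot.liftAlgHom_of, LaurentPolynomial.T, AddMonoidAlgebra.lift_single]
    simp [scaledPowers]
  · exact AdjoinRoot.liftAlgHom_root _ _ _ _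

/-- If `b² = a^{m}`, the endomorphism `t ↦ a t⁻¹`, `u ↦ b t^{-m} u` is an involution. -/
lemma comp_self_eq_id {p : LaurentPolynomial ℂ} {f : HypRing p →ₐ[ℂ] HypRing p} {a b : ℂ}
    (ha : a ≠ 0) {m : ℤ} (ht : f (tP p 1) = a • tP p (-1))
    (hu : f (uE p) = b • (tP p (-m) * uE p)) (hb : b ^ 2 = a ^ m) :
    f.comp f = AlgHom.id ℂ (HypRing p) := by
  apply hypRing_algHom_ext
  · simp [ht, map_tP f ha ht, smul_smul, ha]
  · have hm : a ^ m ≠ 0 := zpow_ne_zero _ ha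
    have hs : b * (a ^ (-m) * b) = 1 := by
      rw [zpow_neg, mul_left_comm, ← sq, hb, inv_mul_cancel₀ hm]
    rw [AlgHom.comp_apply, hu, map_smul, map_mul, map_tP f ha ht, hu, smul_mul_smul_comm,
      smul_smul, hs, one_smul, ← mul_assoc, ← tP_add]
    simp [tP_zero]

/-- Roots paired off by `α_i α_{β i} = q` make `p = t ∏ (t - α_i)` self-reciprocal under
`t ↦ q t⁻¹`. -/
lemma lift_reciprocal {N : ℕ} (hN : Even N) {α : Fin N → ℂ} {p : LaurentPolynomial ℂ}
    (hp : p = LaurentPolynomial.T 1 *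
      ∏ i : Fin N, (LaurentPolynomial.T 1 - LaurentPolynomial.C (α i)))
    {q : ℂ} (hq : q ≠ 0) (β : Equiv.Perm (Fin N)) (hβ : ∀ i, α i * α (β i) = q) :
    AddMonoidAlgebra.lift ℂ (HypRing p) ℤ (scaledPowers p q hq (-1)) p =
      (q * ∏ i, α i) • (tP p (-(N + 2)) * uE p ^ 2) := by
  have hT : AddMonoidAlgebra.lift ℂ (HypRing p) ℤ (scaledPowers p q hq (-1))
      (LaurentPolynomial.T 1) = q • tP p (-1) := by
    rw [LaurentPolynomial.T, AddMonoidAlgebra.lift_single]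
    simp [scaledPowers]
  have hC (a : ℂ) : AddMonoidAlgebra.lift ℂ (HypRing p) ℤ (scaledPowers p q hq (-1))
      (LaurentPolynomial.C a) = algebraMap ℂ _ a := by
    rw [LaurentPolynomial.C_eq_algebraMap, AlgHom.commutes]
  have hinv : tP p (-1) * tP p 1 = 1 := by rw [← tP_add]; simp [tP_zero]
  have hfac (i : Fin N) : q • tP p (-1) - algebraMap ℂ (HypRing p) (α i) =
      -(algebraMap ℂ (HypRing p) (α i) * tP p (-1) *
        (tP p 1 - algebraMap ℂ (HypRing p) (α (β i)))) := by
    rw [← hβ i, Algebra.smul_def, map_mul]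
    linear_combination algebraMap ℂ (HypRing p) (α i) * hinv
  have hprod : ∏ i, (tP p 1 - algebraMap ℂ (HypRing p) (α (β i))) =
      ∏ i, (tP p 1 - algebraMap ℂ (HypRing p) (α i)) :=
    Equiv.prod_comp β fun i => tP p 1 - algebraMap ℂ (HypRing p) (α i)
  have hu : uE p ^ 2 = tP p 1 * ∏ i, (tP p 1 - algebraMap ℂ (HypRing p) (α i)) := by
    rw [uE_sq]
    conv_lhs => arg 2; rw [hp]
    rw [map_mul, map_prod]
    simp only [map_sub, of_C]
    rfl
  have ht : tP p (-(N + 2)) * tP p 1 = tP p (-1) * tP p (-1) ^ N := by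
    rw [tP_pow, ← tP_add, ← tP_add]
    congr 1
    ring
  rw [hu]
  conv_lhs => arg 2; rw [hp]
  rw [map_mul, map_prod]
  simp only [map_sub, hT, hC, hfac]
  rw [Finset.prod_neg, Finset.card_univ, Fintype.card_fin, hN.neg_one_pow, one_mul,
    Finset.prod_mul_distrib, Finset.prod_mul_distrib, hprod, Finset.prod_const,
    Finset.card_univ, Fintype.card_fin, ← mul_assoc (tP p _), ht, Algebra.smul_def,
    Algebra.smul_def, map_mul, map_prod]
  ring

/-- `exp(2πi/2k)` is a `k`-th root of `-1`. -/
lemma exp_pi_div_pow {k : ℕ} (hk : 1 ≤ k) :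
    Complex.exp (2 * Real.pi * Complex.I / (2 * k)) ^ k = -1 := by
  have hk' : (k : ℂ) ≠ 0 := by exact_mod_cast (by omega : k ≠ 0)
  rw [← Complex.exp_nat_mul, ← Complex.exp_pi_mul_I]
  congr 1
  field_simp

/-- Case (a): the assignments `ψ_c^±(t) = c²t⁻¹`, `ψ_c^±(u) = ±c^{n+1}t^{-n-1}u` extend to
`ℂ`-algebra automorphisms of `R` with `(ψ_c^±)² = id`, and
`ψ_c^+ ∘ φ_ξ^+ ∘ (ψ_c^+)⁻¹` sends `t ↦ ξ^{-2}t`, `u ↦ (−1)^l ξ^{-1}u`, where `l = 2n/k`. -/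
theorem dihedral_automorphisms_case_a (n k l : ℕ) (hn : 1 ≤ n) (hk : 1 ≤ k)
    (hl : k * l = 2 * n)
    (α : Fin (2 * n) → ℂ) (hα0 : ∀ i, α i ≠ 0) (hαinj : Function.Injective α)
    (p : LaurentPolynomial ℂ)
    (hp : p = LaurentPolynomial.T 1 *
      ∏ i : Fin (2 * n), (LaurentPolynomial.T 1 - LaurentPolynomial.C (α i)))
    (ζ : ℂ) (hζ : IsPrimitiveRoot ζ k)
    (γ : Equiv.Perm (Fin (2 * n))) (hγ : ∀ i, α (γ i) = ζ * α i)
    (ξ : ℂ) (hξ : ξ = Complex.exp (2 * Real.pi * Complex.I / (2 * k)))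
    (hξ2 : ξ ^ 2 = ζ)
    (c : ℂ) (hc : c ≠ 0)
    (β : Equiv.Perm (Fin (2 * n))) (hβ : ∀ i, α i * α (β i) = c ^ 2)
    (ha1 : ∏ i : Fin (2 * n), α i = c ^ (2 * n)) :
    ∃ ψp ψm : HypRing p ≃ₐ[ℂ] HypRing p,
      (ψp (tP p 1) = c ^ 2 • tP p (-1) ∧
        ψp (uE p) = c ^ (n + 1) • (tP p (-(n : ℤ) - 1) * uE p)) ∧
      (ψm (tP p 1) = c ^ 2 • tP p (-1) ∧
        ψm (uE p) = -(c ^ (n + 1) • (tP p (-(n : ℤ) - 1) * uE p))) ∧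
      ψp ^ 2 = 1 ∧ ψm ^ 2 = 1 ∧
      (∀ φp : HypRing p ≃ₐ[ℂ] HypRing p,
        φp (tP p 1) = ξ ^ 2 • tP p 1 → φp (uE p) = ξ • uE p →
          ψp (φp (ψp.symm (tP p 1))) = (ξ ^ 2)⁻¹ • tP p 1 ∧
          ψp (φp (ψp.symm (uE p))) = ((-1 : ℂ) ^ l * ξ⁻¹) • uE p) := by
  have hq : c ^ 2 ≠ 0 := pow_ne_zero _ hc
  have hlift := lift_reciprocal (even_two_mul n) hp hq β hβ
  have key (b : ℂ) (hb : b ^ 2 = (c ^ 2) ^ (n + 1)) : ∃ ψ : HypRing p ≃ₐ[ℂ] HypRing p,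
      ψ (tP p 1) = c ^ 2 • tP p (-1) ∧ ψ (uE p) = b • (tP p (-(n : ℤ) - 1) * uE p) ∧
      ψ ^ 2 = 1 := by
    obtain ⟨f, ht, hu⟩ := exists_algHom_inversion (b := b) (m := -(n : ℤ) - 1) hq (by
      rw [hlift, ha1, smul_pow, mul_pow, tP_pow, hb]
      congr 1
      · ring
      · congr 2
        push_cast
        ring)
    have hid : f.comp f = AlgHom.id ℂ (HypRing p) := by
      refine comp_self_eq_id (b := b) (m := (n : ℤ) + 1) hq ht ?_ ?_
      · rw [hu, neg_add']
      · rw [hb]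
        norm_cast
    refine ⟨AlgEquiv.ofAlgHom f f hid hid, ht, hu, ?_⟩
    ext x
    exact DFunLike.congr_fun hid x
  obtain ⟨ψp, hpt, hpu, hp2⟩ := key (c ^ (n + 1)) (by ring)
  obtain ⟨ψm, hmt, hmu, hm2⟩ := key (-c ^ (n + 1)) (by ring)
  refine ⟨ψp, ψm, ⟨hpt, hpu⟩, ⟨hmt, by rw [hmu, neg_smul]⟩, hp2, hm2, fun φ hφt hφu => ?_⟩
  have hξ0 : ξ ≠ 0 := by
    rw [hξ]
    exact Complex.exp_ne_zero _
  have hinv (x : HypRing p) : ψp (ψp x) = x := DFunLike.congr_fun hp2 x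
  have hsymm (x : HypRing p) : ψp.symm x = ψp x := by
    rw [AlgEquiv.symm_apply_eq, hinv]
  have hφ (i : ℤ) : φ (tP p i) = (ξ ^ 2) ^ i • tP p i := by
    simpa using map_tP (φ : HypRing p →ₐ[ℂ] HypRing p) (pow_ne_zero 2 hξ0) hφt i
  constructor
  · rw [hsymm, hpt, map_smul, hφ, smul_comm, ← hpt, map_smul, hinv, zpow_neg_one]
  · have hpow : ξ ^ (2 * n) = (-1) ^ l := by
      rw [← hl, pow_mul, hξ, exp_pi_div_pow hk]
    have hsq : ((-1 : ℂ) ^ l) * (-1) ^ l = 1 := by rw [← mul_pow]; simp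
    have hscalar : (ξ ^ 2) ^ (-(n : ℤ) - 1) * ξ = (-1) ^ l * ξ⁻¹ := by
      have hz : (ξ ^ 2) ^ (-(n : ℤ) - 1) = (ξ ^ (2 * n) * ξ ^ 2)⁻¹ := by
        rw [← neg_add', zpow_neg, pow_mul, ← pow_succ]
        norm_cast
      rw [hz, hpow, mul_inv, inv_eq_of_mul_eq_one_left hsq]
      field_simp
    rw [hsymm, hpu, map_smul, map_mul, hφ, hφu, smul_mul_smul_comm, smul_comm, ← hpu,
      map_smul, hinv, hscalar]

end
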